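/- arXiv:2406.12149 — 2 statements merged into one kernel-verified Lean document; each statement's English description precedes it below -/
import Mathlib

section
/- Let k ≥ 2, n ≥ 1, w ≥ 1 be integers and Δ a real number with 0 ≤ Δ ≤ n/(2(k−1)). Suppose there exists a length-n width-w ROBP P over the alphabet [k] that computes ApproxCount_k[n,Δ]. Let m be the largest integer such that m ≤ n−1 and binom(m+k−1, k−1) ≤ w. Then binom(m+k, k) + (n−m−1)·w ≥ C(n − 2(k−1)Δ + k−1, k), where C(x,k) denotes the generalized binomial coefficient x(x−1)⋯(x−k+1)/k! for a real number x. -/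
open Finset

/-- A length-`n` read-once branching program over alphabet `σ` with outputs in `Out`.
Layer `t` has vertex set `Fin (size t)` (only layers `0, 1, …, n` are relevant);
layer `0` consists of a single start vertex, and each vertex of layer `t` has an
outgoing edge to layer `t+1` for every letter of the alphabet. -/
structure ROBP (σ Out : Type) (n : ℕ) where
  size : ℕ → ℕ
  size0 : size 0 = 1
  sizePos : ∀ t, 0 < size t
  step : (t : ℕ) → Fin (size t) → σ → Fin (size (t + 1))
  out : Fin (size n) → Out

namespace ROBP

variable {σ Out : Type} {n : ℕ}

/-- The vertex reached in layer `t` on input `x` (only `x 0, …, x (t-1)` matter). -/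
def state (P : ROBP σ Out n) (x : ℕ → σ) : (t : ℕ) → Fin (P.size t)
  | 0 => ⟨0, P.sizePos 0⟩
  | t + 1 => P.step t (state P x t) (x t)

/-- The width of an ROBP: the maximal number of vertices in a single layer. -/
def width (P : ROBP σ Out n) : ℕ := (Finset.range (n + 1)).sup P.size

/-- Every vertex (in the relevant layers) is reached by some input: no useless vertices. -/
def Reachable (P : ROBP σ Out n) : Prop :=
  ∀ t, t ≤ n → ∀ v : Fin (P.size t), ∃ x : ℕ → σ, P.state x t = v

/-- The output of the program on input `x`. -/
def eval (P : ROBP σ Out n) (x : ℕ → σ) : Out := P.out (P.state x n)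

end ROBP

/-- The number of occurrences of `j` among `x 0, …, x (t-1)`. -/
def countK {k : ℕ} (x : ℕ → Fin k) (t : ℕ) (j : Fin k) : ℕ :=
  ((Finset.range t).filter fun i => x i = j).card

/-- `P` computes `ApproxCount_k[n, Δ]`: on every input, each of the `k` outputs estimates
the frequency of the corresponding letter within additive error `Δ`. -/
def ComputesApproxCountK (k n : ℕ) (Δ : ℝ) (P : ROBP (Fin k) (Fin k → ℝ) n) : Prop :=
  ∀ x : ℕ → Fin k, ∀ j : Fin k, |P.eval x j - (countK x n j : ℝ)| ≤ Δ

/-- `P` computes `ApproxCount[n, Δ]` (the `{0,1}` case). -/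
def ComputesApproxCount (n : ℕ) (Δ : ℝ) (P : ROBP Bool ℝ n) : Prop :=
  ∀ x : ℕ → Bool, |P.eval x - (((Finset.range n).filter fun i => x i = true).card : ℝ)| ≤ Δ

/-- The number of `1`'s in coordinate `j` among `x 0, …, x (t-1)`. -/
def countPar {k : ℕ} (x : ℕ → (Fin k → Bool)) (t : ℕ) (j : Fin k) : ℕ :=
  ((Finset.range t).filter fun i => x i j = true).card

/-- `P` computes `ApproxCount^par_k[n, Δ]`. -/
def ComputesApproxCountPar (k n : ℕ) (Δ : ℝ) (P : ROBP (Fin k → Bool) (Fin k → ℝ) n) : Prop :=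
  ∀ x : ℕ → (Fin k → Bool), ∀ j : Fin k, |P.eval x j - (countPar x n j : ℝ)| ≤ Δ

/-- The inclusion `[k-1] ⊆ [k]`. -/
def idx {k : ℕ} (j : Fin (k - 1)) : Fin k := Fin.castLE (Nat.sub_le k 1) j

/-- `a_j(v)`: the minimal possible number of `j`'s in the first `t` input words
reaching the vertex `v` of layer `t`. -/
noncomputable def rectLo {k n : ℕ} (P : ROBP (Fin k) (Fin k → ℝ) n) (t : ℕ)
    (v : Fin (P.size t)) (j : Fin (k - 1)) : ℕ :=
  sInf {c | ∃ x : ℕ → Fin k, P.state x t = v ∧ countK x t (idx j) = c}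

/-- `b_j(v)`: the maximal possible number of `j`'s in the first `t` input words
reaching the vertex `v` of layer `t`. -/
noncomputable def rectHi {k n : ℕ} (P : ROBP (Fin k) (Fin k → ℝ) n) (t : ℕ)
    (v : Fin (P.size t)) (j : Fin (k - 1)) : ℕ :=
  sSup {c | ∃ x : ℕ → Fin k, P.state x t = v ∧ countK x t (idx j) = c}

/-- `a_j(v)` for the `k`-parallel case. -/
noncomputable def parLo {k n : ℕ} (P : ROBP (Fin k → Bool) (Fin k → ℝ) n) (t : ℕ)
    (v : Fin (P.size t)) (j : Fin k) : ℕ :=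
  sInf {c | ∃ x : ℕ → (Fin k → Bool), P.state x t = v ∧ countPar x t j = c}

/-- `b_j(v)` for the `k`-parallel case. -/
noncomputable def parHi {k n : ℕ} (P : ROBP (Fin k → Bool) (Fin k → ℝ) n) (t : ℕ)
    (v : Fin (P.size t)) (j : Fin k) : ℕ :=
  sSup {c | ∃ x : ℕ → (Fin k → Bool), P.state x t = v ∧ countPar x t j = c}

/-- The axis-parallel box `[lo 1, hi 1] × ⋯ × [lo m, hi m]` (as a set of integer points). -/
def rect {m : ℕ} (lo hi : Fin m → ℕ) : Set (Fin m → ℕ) :=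
  {y | ∀ j, lo j ≤ y j ∧ y j ≤ hi j}

/-- The potential `φ_t(x)` of the point `x` (k-counter case): the maximum, over all
rectangle labels of layer `t` containing `x`, of `min{Σ_j b_j, t} - Σ_j x_j`. -/
noncomputable def phiK {k n : ℕ} (P : ROBP (Fin k) (Fin k → ℝ) n) (t : ℕ)
    (x : Fin (k - 1) → ℕ) : ℕ :=
  Finset.univ.sup fun v : Fin (P.size t) =>
    if ∀ j, rectLo P t v j ≤ x j ∧ x j ≤ rectHi P t v j then
      min (∑ j, rectHi P t v j) t - ∑ j, x j
    else 0

/-- `T_{t,k}`: tuples of naturals summing to at most `t`. -/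
def Tset (k t : ℕ) : Finset (Fin (k - 1) → ℕ) :=
  (Fintype.piFinset fun _ => Finset.range (t + 1)).filter fun x => ∑ j, x j ≤ t

/-- The total potential `Φ_t` of layer `t` (k-counter case). -/
noncomputable def PhiK {k n : ℕ} (P : ROBP (Fin k) (Fin k → ℝ) n) (t : ℕ) : ℕ :=
  ∑ x ∈ Tset k t, phiK P t x

/-- The potential `φ_t(x)` of the point `x` (k-parallel case). -/
noncomputable def phiPar {k n : ℕ} (P : ROBP (Fin k → Bool) (Fin k → ℝ) n) (t : ℕ)
    (x : Fin k → ℕ) : ℕ :=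
  Finset.univ.sup fun v : Fin (P.size t) =>
    if ∀ j, parLo P t v j ≤ x j ∧ x j ≤ parHi P t v j then
      (∑ j, parHi P t v j) - ∑ j, x j
    else 0

/-- The total potential `Φ_t` of layer `t` (k-parallel case): the sum of `φ_t(x)`
over `x ∈ {0, 1, …, ⌊n/10⌋}^k`. -/
noncomputable def PhiPar {k n : ℕ} (P : ROBP (Fin k → Bool) (Fin k → ℝ) n) (t : ℕ) : ℕ :=
  ∑ x ∈ Fintype.piFinset (fun _ : Fin k => Finset.range (n / 10 + 1)), phiPar P t x

/-- The generalized binomial coefficient `C(x, m) = x (x-1) ⋯ (x-m+1) / m!`. -/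
noncomputable def genChoose (x : ℝ) (m : ℕ) : ℝ :=
  (∏ i ∈ Finset.range m, (x - (i : ℝ))) / (Nat.factorial m : ℝ)

namespace ROBP

variable {σ Out : Type} {n : ℕ}

theorem state_congr (P : ROBP σ Out n) {x y : ℕ → σ} :
    ∀ {t : ℕ}, (∀ i < t, x i = y i) → P.state x t = P.state y t
  | 0, _ => rfl
  | t + 1, h => by
    simp only [state]
    rw [state_congr P fun i hi => h i (by omega), h t (by omega)]

theorem state_update_succ (P : ROBP σ Out n) (x : ℕ → σ) (t : ℕ) (a : σ) :
    P.state (Function.update x t a) (t + 1) = P.step t (P.state x t) a := by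
  have h : P.state (Function.update x t a) t = P.state x t :=
    P.state_congr fun i hi => Function.update_of_ne (by omega) _ _
  simp only [state]
  rw [h, Function.update_self]

end ROBP

theorem countK_le {k : ℕ} (x : ℕ → Fin k) (t : ℕ) (j : Fin k) : countK x t j ≤ t :=
  (card_filter_le _ _).trans (card_range t).le

theorem countK_update_succ {k : ℕ} (x : ℕ → Fin k) (t : ℕ) (a j : Fin k) :
    countK (Function.update x t a) (t + 1) j = countK x t j + if a = j then 1 else 0 := by
  have h : ((range t).filter fun i => Function.update x t a i = j) =
      (range t).filter fun i => x i = j := by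
    refine filter_congr fun i hi => ?_
    rw [Function.update_of_ne (mem_range.1 hi).ne]
  unfold countK
  rw [range_add_one, filter_insert, Function.update_self, h]
  split_ifs
  · rw [card_insert_of_notMem (by simp)]
  · rfl

theorem idx_injective {k : ℕ} : Function.Injective (idx (k := k)) :=
  Fin.castLE_injective (Nat.sub_le k 1)

theorem exists_ne_idx {k : ℕ} (hk : 1 ≤ k) : ∃ z : Fin k, ∀ j, z ≠ idx j := by
  refine ⟨⟨k - 1, by omega⟩, fun j h => ?_⟩
  have := congrArg Fin.val h
  have := j.2
  simp only [idx, Fin.val_castLE] at *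
  omega

theorem exists_countK_eq {k : ℕ} (hk : 1 ≤ k) (t : ℕ) (c : Fin (k - 1) → ℕ) (hc : ∑ j, c j ≤ t) :
    ∃ x : ℕ → Fin k, ∀ j, countK x t (idx j) = c j := by
  obtain ⟨z, hz⟩ := exists_ne_idx hk
  induction t generalizing c with
  | zero =>
    refine ⟨fun _ => z, fun j => ?_⟩
    have := single_le_sum (f := c) (fun _ _ => Nat.zero_le _) (mem_univ j)
    simp only [countK, range_zero, filter_empty, card_empty]
    omega
  | succ t ih =>
    by_cases h : ∃ i, c i ≠ 0
    · obtain ⟨i, hi⟩ := h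
      have hsum : ∑ j, c j = ∑ j, Function.update c i (c i - 1) j + 1 := by
        rw [sum_update_of_mem (mem_univ i), ← add_sum_erase _ _ (mem_univ i),
          ← sdiff_singleton_eq_erase]
        omega
      obtain ⟨x, hx⟩ := ih (Function.update c i (c i - 1)) (by omega)
      refine ⟨Function.update x t (idx i), fun j => ?_⟩
      rw [countK_update_succ, hx]
      by_cases hij : i = j
      · subst hij
        rw [Function.update_self, if_pos rfl]
        omega
      · rw [Function.update_of_ne (Ne.symm hij), if_neg fun e => hij (idx_injective e), add_zero]
    · push Not at h
      refine ⟨fun _ => z, fun j => ?_⟩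
      simp [countK, h, hz]

section Rectangles

variable {k n : ℕ} (P : ROBP (Fin k) (Fin k → ℝ) n)

theorem bddAbove_countK {t : ℕ} (v : Fin (P.size t)) (j : Fin (k - 1)) :
    BddAbove {c | ∃ x : ℕ → Fin k, P.state x t = v ∧ countK x t (idx j) = c} :=
  ⟨t, by rintro _ ⟨x, -, rfl⟩; exact countK_le _ _ _⟩

theorem rectLo_le (t : ℕ) (x : ℕ → Fin k) (j : Fin (k - 1)) :
    rectLo P t (P.state x t) j ≤ countK x t (idx j) :=
  Nat.sInf_le ⟨x, rfl, rfl⟩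

theorem le_rectHi (t : ℕ) (x : ℕ → Fin k) (j : Fin (k - 1)) :
    countK x t (idx j) ≤ rectHi P t (P.state x t) j :=
  le_csSup (bddAbove_countK P _ j) ⟨x, rfl, rfl⟩

variable {P}

theorem exists_countK_eq_rectLo (hreach : P.Reachable) {t : ℕ} (ht : t ≤ n)
    (v : Fin (P.size t)) (j : Fin (k - 1)) :
    ∃ x : ℕ → Fin k, P.state x t = v ∧ countK x t (idx j) = rectLo P t v j := by
  obtain ⟨x, hx⟩ := hreach t ht v
  exact Nat.sInf_mem (s := {c | ∃ x : ℕ → Fin k, P.state x t = v ∧ countK x t (idx j) = c})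
    ⟨_, x, hx, rfl⟩

theorem exists_countK_eq_rectHi (hreach : P.Reachable) {t : ℕ} (ht : t ≤ n)
    (v : Fin (P.size t)) (j : Fin (k - 1)) :
    ∃ x : ℕ → Fin k, P.state x t = v ∧ countK x t (idx j) = rectHi P t v j := by
  obtain ⟨x, hx⟩ := hreach t ht v
  exact Nat.sSup_mem (s := {c | ∃ x : ℕ → Fin k, P.state x t = v ∧ countK x t (idx j) = c})
    ⟨_, x, hx, rfl⟩ (bddAbove_countK P v j)

theorem rectLo_step_le (hreach : P.Reachable) {t : ℕ} (ht : t ≤ n) (v : Fin (P.size t))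
    (a : Fin k) (j : Fin (k - 1)) :
    rectLo P (t + 1) (P.step t v a) j ≤ rectLo P t v j + if a = idx j then 1 else 0 := by
  obtain ⟨x, rfl, hx⟩ := exists_countK_eq_rectLo hreach ht v j
  rw [← hx, ← countK_update_succ, ← P.state_update_succ]
  exact rectLo_le P _ _ _

theorem rectHi_add_le_step (hreach : P.Reachable) {t : ℕ} (ht : t ≤ n) (v : Fin (P.size t))
    (a : Fin k) (j : Fin (k - 1)) :
    rectHi P t v j + (if a = idx j then 1 else 0) ≤ rectHi P (t + 1) (P.step t v a) j := by
  obtain ⟨x, rfl, hx⟩ := exists_countK_eq_rectHi hreach ht v j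
  rw [← hx, ← countK_update_succ, ← P.state_update_succ]
  exact le_rectHi P _ _ _

theorem rectHi_sub_rectLo_le (hreach : P.Reachable) {Δ : ℝ}
    (hcomp : ComputesApproxCountK k n Δ P) (v : Fin (P.size n)) (j : Fin (k - 1)) :
    (rectHi P n v j : ℝ) - rectLo P n v j ≤ 2 * Δ := by
  obtain ⟨x, hxv, hx⟩ := exists_countK_eq_rectHi hreach le_rfl v j
  obtain ⟨y, hyv, hy⟩ := exists_countK_eq_rectLo hreach le_rfl v j
  have h₁ := abs_le.1 (hcomp x (idx j))
  have h₂ := abs_le.1 (hcomp y (idx j))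
  simp only [ROBP.eval, hxv, hyv, hx, hy] at h₁ h₂
  linarith [h₁.1, h₂.2]

end Rectangles

theorem mem_Tset {k t : ℕ} {x : Fin (k - 1) → ℕ} : x ∈ Tset k t ↔ ∑ j, x j ≤ t := by
  simp only [Tset, mem_filter, Fintype.mem_piFinset, mem_range, and_iff_right_iff_imp]
  intro h j
  have := single_le_sum (f := x) (fun _ _ => Nat.zero_le _) (mem_univ j)
  omega

theorem Tset_mono {k : ℕ} : Monotone (Tset k) := fun _ _ h _ hx =>
  mem_Tset.2 ((mem_Tset.1 hx).trans h)

theorem card_Tset {k : ℕ} (hk : 2 ≤ k) (t : ℕ) : #(Tset k t) = (t + k - 1).choose (k - 1) := by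
  have h : Tset k t =
      (range (t + 1)).biUnion fun s => piAntidiag (univ : Finset (Fin (k - 1))) s := by
    ext x
    simp [mem_Tset]
  rw [h, card_biUnion]
  · have hc : ∀ s, #(piAntidiag (univ : Finset (Fin (k - 1))) s) = (k - 1).multichoose s := by
      intro s
      have := card_finsuppAntidiag_nat_eq_multichoose (s := (univ : Finset (Fin (k - 1)))) s
      rwa [finsuppAntidiag, card_map, card_attach, card_univ, Fintype.card_fin] at this
    simp only [hc, Nat.sum_range_multichoose]
    congr 1
    omega
  · intro s _ s' _ hs
    rw [Function.onFun, disjoint_left]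
    intro x hx hx'
    simp only [mem_piAntidiag] at hx hx'
    exact hs (hx.1.symm.trans hx'.1)

theorem sum_Tset_sub (k N : ℕ) :
    ∑ x ∈ Tset k N, (N - ∑ j, x j) = ∑ t ∈ range N, #(Tset k t) := by
  induction N with
  | zero => simp
  | succ N ih =>
    rw [sum_range_succ, ← ih, ← sum_subset (Tset_mono N.le_succ), card_eq_sum_ones,
      ← sum_add_distrib]
    · refine sum_congr rfl fun x hx => ?_
      have := mem_Tset.1 hx
      omega
    · intro x _ hx
      rw [mem_Tset] at hx
      omega

theorem sum_card_Tset {k : ℕ} (hk : 2 ≤ k) (N : ℕ) :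
    ∑ t ∈ range (N + 1), #(Tset k t) = (N + k).choose k := by
  obtain ⟨d, rfl⟩ : ∃ d, k = d + 1 := ⟨k - 1, by omega⟩
  have := Nat.sum_range_add_choose N d
  simp only [card_Tset hk]
  simpa [add_assoc] using this

section Potential

variable {k n : ℕ} {P : ROBP (Fin k) (Fin k → ℝ) n}

theorem le_phiK {t : ℕ} {v : Fin (P.size t)} {x : Fin (k - 1) → ℕ}
    (h : ∀ j, rectLo P t v j ≤ x j ∧ x j ≤ rectHi P t v j) :
    min (∑ j, rectHi P t v j) t - ∑ j, x j ≤ phiK P t x := by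
  have := le_sup (f := fun v : Fin (P.size t) =>
    if ∀ j, rectLo P t v j ≤ x j ∧ x j ≤ rectHi P t v j then
      min (∑ j, rectHi P t v j) t - ∑ j, x j
    else 0) (mem_univ v)
  rwa [if_pos h] at this

theorem exists_phiK_eq (hk : 1 ≤ k) {t : ℕ} {x : Fin (k - 1) → ℕ} (hx : x ∈ Tset k t) :
    ∃ v : Fin (P.size t), (∀ j, rectLo P t v j ≤ x j ∧ x j ≤ rectHi P t v j) ∧
      phiK P t x = min (∑ j, rectHi P t v j) t - ∑ j, x j := by
  obtain ⟨y, hy⟩ := exists_countK_eq hk t x (mem_Tset.1 hx)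
  have h₀ : ∀ j, rectLo P t (P.state y t) j ≤ x j ∧ x j ≤ rectHi P t (P.state y t) j :=
    fun j => hy j ▸ ⟨rectLo_le P t y j, le_rectHi P t y j⟩
  obtain ⟨v, -, hv⟩ := exists_mem_eq_sup (univ : Finset (Fin (P.size t)))
    ⟨P.state y t, mem_univ _⟩ (fun v : Fin (P.size t) =>
      if ∀ j, rectLo P t v j ≤ x j ∧ x j ≤ rectHi P t v j then
        min (∑ j, rectHi P t v j) t - ∑ j, x j
      else 0)
  change phiK P t x = _ at hv
  split_ifs at hv with h
  · exact ⟨v, h, hv⟩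
  · have := le_phiK h₀
    exact ⟨_, h₀, by omega⟩

theorem phiK_le_succ (hk : 1 ≤ k) (hreach : P.Reachable) {t : ℕ} (ht : t ≤ n)
    {x : Fin (k - 1) → ℕ} (hx : x ∈ Tset k t) : phiK P t x ≤ phiK P (t + 1) x := by
  obtain ⟨v, hv, hphi⟩ := exists_phiK_eq (P := P) hk hx
  obtain ⟨z, hz⟩ := exists_ne_idx hk
  have hlo := fun j => rectLo_step_le hreach ht v z j
  have hhi := fun j => rectHi_add_le_step hreach ht v z j
  simp only [if_neg (hz _), add_zero] at hlo hhi
  have := le_phiK (P := P) (x := x) fun j => ⟨(hlo j).trans (hv j).1, (hv j).2.trans (hhi j)⟩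
  have := sum_le_sum fun j (_ : j ∈ univ) => hhi j
  omega

theorem phiK_lt_succ (hk : 1 ≤ k) (hreach : P.Reachable) {t : ℕ} (ht : t ≤ n)
    {x : Fin (k - 1) → ℕ} (hx : x ∈ Tset k t) (hxlo : x ∉ univ.image (rectLo P t)) :
    phiK P t x + 1 ≤ phiK P (t + 1) x := by
  obtain ⟨v, hv, hphi⟩ := exists_phiK_eq (P := P) hk hx
  obtain ⟨i, hi⟩ : ∃ i, rectLo P t v i < x i := by
    by_contra! h
    exact hxlo (mem_image.2 ⟨v, mem_univ v, funext fun j => (hv j).1.antisymm (h j)⟩)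
  have hlo := fun j => rectLo_step_le hreach ht v (idx i) j
  have hhi := fun j => rectHi_add_le_step hreach ht v (idx i) j
  simp only [idx_injective.eq_iff] at hlo hhi
  have hmem : ∀ j, rectLo P (t + 1) (P.step t v (idx i)) j ≤ x j ∧
      x j ≤ rectHi P (t + 1) (P.step t v (idx i)) j := by
    intro j
    refine ⟨(hlo j).trans ?_, (hv j).2.trans (le_self_add.trans (hhi j))⟩
    split_ifs with h
    · exact h ▸ hi
    · exact (hv j).1
  have := le_phiK hmem
  have hsum := sum_le_sum fun j (_ : j ∈ univ) => hhi j
  rw [sum_add_distrib, sum_ite_eq, if_pos (mem_univ i)] at hsum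
  have := sum_le_sum fun j (_ : j ∈ univ) => (hv j).2
  have := mem_Tset.1 hx
  omega

theorem PhiK_add_card_le (hk : 1 ≤ k) (hreach : P.Reachable) {t : ℕ} (ht : t ≤ n) :
    PhiK P t + #(Tset k t) ≤ PhiK P (t + 1) + min #(Tset k t) (P.size t) := by
  set B := univ.image (rectLo P t)
  have hcard : #((Tset k t).filter (· ∈ B)) ≤ min #(Tset k t) (P.size t) := by
    refine le_min (card_filter_le _ _) ?_
    calc #((Tset k t).filter (· ∈ B)) ≤ #B := card_le_card fun x hx => (mem_filter.1 hx).2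
      _ ≤ P.size t := card_image_le.trans (by simp)
  have h₁ : ∑ x ∈ Tset k t, (phiK P t x + 1) ≤
      ∑ x ∈ Tset k t, (phiK P (t + 1) x + if x ∈ B then 1 else 0) := by
    refine sum_le_sum fun x hx => ?_
    split_ifs with h
    · exact Nat.add_le_add_right (phiK_le_succ hk hreach ht hx) 1
    · exact phiK_lt_succ hk hreach ht hx h
  rw [sum_add_distrib, sum_add_distrib, ← card_eq_sum_ones, ← card_filter] at h₁
  have h₂ : ∑ x ∈ Tset k t, phiK P (t + 1) x ≤ PhiK P (t + 1) :=
    sum_le_sum_of_subset (Tset_mono t.le_succ)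
  unfold PhiK at *
  omega

theorem sum_card_Tset_le (hk : 1 ≤ k) (hreach : P.Reachable) {t : ℕ} (ht : t ≤ n) :
    ∑ s ∈ range t, #(Tset k s) ≤ PhiK P t + ∑ s ∈ range t, min #(Tset k s) (P.size s) := by
  induction t with
  | zero => simp
  | succ t ih =>
    have := ih (by omega)
    have := PhiK_add_card_le hk hreach (P := P) (t := t) (by omega)
    rw [sum_range_succ, sum_range_succ]
    omega

theorem phiK_le_sub (t : ℕ) (x : Fin (k - 1) → ℕ) : phiK P t x ≤ t - ∑ j, x j := by
  refine Finset.sup_le fun v _ => ?_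
  split_ifs <;> omega

theorem phiK_le_error (hk : 1 ≤ k) (hreach : P.Reachable) {Δ : ℝ}
    (hcomp : ComputesApproxCountK k n Δ P) {x : Fin (k - 1) → ℕ} (hx : x ∈ Tset k n) :
    (phiK P n x : ℝ) ≤ 2 * ((k : ℝ) - 1) * Δ := by
  obtain ⟨v, hv, hphi⟩ := exists_phiK_eq (P := P) hk hx
  have h₁ : phiK P n x + ∑ j, x j ≤ ∑ j, rectHi P n v j := by
    have := sum_le_sum fun j (_ : j ∈ univ) => (hv j).2
    omega
  have h₂ : ∑ j, ((rectHi P n v j : ℝ) - x j) ≤ ∑ _j : Fin (k - 1), 2 * Δ := by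
    refine sum_le_sum fun j _ => ?_
    have : (rectLo P n v j : ℝ) ≤ x j := mod_cast (hv j).1
    linarith [rectHi_sub_rectLo_le hreach hcomp v j]
  rw [sum_sub_distrib, sum_const, card_univ, Fintype.card_fin, nsmul_eq_mul,
    Nat.cast_sub hk, Nat.cast_one] at h₂
  have h₃ : (phiK P n x : ℝ) + ∑ j, (x j : ℝ) ≤ ∑ j, (rectHi P n v j : ℝ) := mod_cast h₁
  linarith

end Potential

theorem prod_add_le_interpolation (N θ : ℝ) (hN : 0 ≤ N) (h0 : 0 ≤ θ) (h1 : θ ≤ 1) (k : ℕ) :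
    ∏ i ∈ range k, (N + θ + i) ≤
      (1 - θ) * ∏ i ∈ range k, (N + i) + θ * ∏ i ∈ range k, (N + 1 + i) := by
  induction k with
  | zero => simp
  | succ k ih =>
    have hAB : ∏ i ∈ range k, (N + i) ≤ ∏ i ∈ range k, (N + 1 + i) :=
      prod_le_prod (fun i _ => by positivity) fun i _ => by linarith
    simp only [prod_range_succ]
    have h₁ := mul_le_mul_of_nonneg_right ih (show 0 ≤ N + θ + k by positivity)
    nlinarith [mul_nonneg (mul_nonneg h0 (sub_nonneg.2 h1)) (sub_nonneg.2 hAB)]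

theorem prod_range_add_eq_choose (N k : ℕ) :
    ∏ i ∈ range k, ((N : ℝ) + i) = k.factorial * ((N + k - 1).choose k : ℝ) := by
  have h := Nat.ascFactorial_eq_factorial_mul_choose' N k
  rw [Nat.ascFactorial_eq_prod_range] at h
  exact_mod_cast h

theorem genChoose_le {k : ℕ} (hk : 1 ≤ k) (N : ℕ) (θ : ℝ) (h0 : 0 ≤ θ) (h1 : θ ≤ 1) :
    genChoose (N + θ + k - 1) k ≤
      ((N + k - 1).choose k : ℝ) + θ * ((N + k - 1).choose (k - 1) : ℝ) := by
  have hrefl : ∏ i ∈ range k, ((N : ℝ) + θ + k - 1 - i) = ∏ i ∈ range k, ((N : ℝ) + θ + i) := by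
    rw [← prod_range_reflect]
    refine prod_congr rfl fun i hi => ?_
    have := mem_range.1 hi
    rw [Nat.sub_sub, Nat.cast_sub (by omega)]
    push_cast
    ring
  have h := prod_add_le_interpolation N θ N.cast_nonneg h0 h1 k
  have hA := prod_range_add_eq_choose N k
  have hB := prod_range_add_eq_choose (N + 1) k
  have hpascal : (N + 1 + k - 1).choose k = (N + k - 1).choose (k - 1) + (N + k - 1).choose k := by
    obtain ⟨d, rfl⟩ : ∃ d, k = d + 1 := ⟨k - 1, by omega⟩
    simp only [show N + 1 + (d + 1) - 1 = N + d + 1 by omega, show N + (d + 1) - 1 = N + d by omega,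
      Nat.add_sub_cancel]
    exact Nat.choose_succ_succ _ _
  rw [hpascal] at hB
  push_cast at hB
  unfold genChoose
  rw [hrefl, div_le_iff₀ (by positivity)]
  rw [hA, hB] at h
  linarith

theorem genChoose_le_sum_Tset {k : ℕ} (hk : 2 ≤ k) (N : ℕ) (θ : ℝ) (h0 : 0 ≤ θ) (h1 : θ ≤ 1) :
    genChoose (N + θ + k - 1) k ≤ ∑ x ∈ Tset k N, ((N : ℝ) + θ - ∑ j, (x j : ℝ)) := by
  refine (genChoose_le (by omega) N θ h0 h1).trans_eq ?_
  have hsum : ∑ x ∈ Tset k N, ((N : ℝ) - ∑ j, (x j : ℝ)) = ((N + k - 1).choose k : ℝ) := by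
    have hN : ∑ t ∈ range N, #(Tset k t) = (N + k - 1).choose k := by
      cases N with
      | zero => rw [range_zero, sum_empty, Nat.choose_eq_zero_of_lt (by omega)]
      | succ N => rw [sum_card_Tset hk]; congr 1; omega
    rw [← hN, ← sum_Tset_sub, Nat.cast_sum]
    refine sum_congr rfl fun x hx => ?_
    rw [Nat.cast_sub (mem_Tset.1 hx), Nat.cast_sum]
  rw [← hsum, ← card_Tset hk, mul_comm, ← nsmul_eq_mul, ← sum_const, ← sum_add_distrib]
  exact sum_congr rfl fun x _ => by ring

theorem sum_min_card_Tset_le {k n w m : ℕ} (hk : 2 ≤ k) (hn : 1 ≤ n)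
    {P : ROBP (Fin k) (Fin k → ℝ) n} (hwidth : P.width ≤ w) (hm : m ≤ n - 1) :
    ∑ t ∈ range n, min #(Tset k t) (P.size t) ≤ (m + k).choose k + (n - 1 - m) * w := by
  rw [← sum_card_Tset hk, ← sum_range_add_sum_Ico _ (show m + 1 ≤ n by omega)]
  refine add_le_add (sum_le_sum fun t _ => min_le_left _ _) ?_
  refine (sum_le_card_nsmul _ _ w fun t ht => (min_le_right _ _).trans ?_).trans_eq ?_
  · exact (le_sup (f := P.size) (mem_range.2 (by have := (mem_Ico.1 ht).2; omega))).trans hwidth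
  · rw [Nat.card_Ico, smul_eq_mul, Nat.sub_sub, add_comm 1 m]

/-- Theorem about the `k`-counter lower bound.
If a length-`n` width-`w` ROBP over `[k]` computes `ApproxCount_k[n,Δ]` with
`0 ≤ Δ ≤ n/(2(k-1))`, and `m` is the largest integer with `m ≤ n-1` and
`binom(m+k-1, k-1) ≤ w`, then
`binom(m+k, k) + (n-m-1)·w ≥ C(n - 2(k-1)Δ + k-1, k)`. -/
theorem stmt0 (k n w : ℕ) (hk : 2 ≤ k) (hn : 1 ≤ n) (hw : 1 ≤ w)
    (Δ : ℝ) (hΔ0 : 0 ≤ Δ) (hΔ1 : Δ ≤ (n : ℝ) / (2 * ((k : ℝ) - 1)))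
    (P : ROBP (Fin k) (Fin k → ℝ) n) (hreach : P.Reachable) (hwidth : P.width ≤ w)
    (hcomp : ComputesApproxCountK k n Δ P)
    (m : ℕ) (hm1 : m ≤ n - 1) (hm2 : Nat.choose (m + k - 1) (k - 1) ≤ w)
    (hmax : ∀ m' : ℕ, m' ≤ n - 1 → Nat.choose (m' + k - 1) (k - 1) ≤ w → m' ≤ m) :
    (Nat.choose (m + k) k : ℝ) + ((n : ℝ) - (m : ℝ) - 1) * (w : ℝ) ≥
      genChoose ((n : ℝ) - 2 * ((k : ℝ) - 1) * Δ + (k : ℝ) - 1) k := by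
  have hk1 : (0 : ℝ) < (k : ℝ) - 1 := by
    have : (2 : ℝ) ≤ k := mod_cast hk
    linarith
  have hDn : 2 * ((k : ℝ) - 1) * Δ ≤ n := by
    rw [le_div_iff₀ (by positivity)] at hΔ1
    linarith
  have hD0 : 0 ≤ 2 * ((k : ℝ) - 1) * Δ := by positivity
  set D := 2 * ((k : ℝ) - 1) * Δ
  set N := ⌊(n : ℝ) - D⌋₊
  have hN0 : (N : ℝ) ≤ n - D := Nat.floor_le (by linarith)
  have hN1 : (n : ℝ) - D < N + 1 := Nat.lt_floor_add_one _
  have hNn : N ≤ n := by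
    have : (N : ℝ) ≤ n := by linarith
    exact_mod_cast this
  have hlow := genChoose_le_sum_Tset hk N (n - D - N) (by linarith) (by linarith)
  rw [show (N : ℝ) + (n - D - N) = n - D by ring] at hlow
  have hmid : ∑ x ∈ Tset k N, ((n : ℝ) - D - ∑ j, (x j : ℝ)) ≤
      ∑ x ∈ Tset k n, (((n - ∑ j, x j : ℕ) : ℝ) - phiK P n x) := by
    refine (sum_le_sum fun x hx => ?_).trans
      (sum_le_sum_of_subset_of_nonneg (Tset_mono hNn) fun x _ _ => ?_)
    · have hxn := Tset_mono hNn hx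
      have := phiK_le_error (by omega) hreach hcomp hxn
      rw [Nat.cast_sub (mem_Tset.1 hxn), Nat.cast_sum]
      linarith
    · exact sub_nonneg.2 (mod_cast phiK_le_sub n x)
  have hpsi := hlow.trans hmid
  rw [sum_sub_distrib, ← Nat.cast_sum, ← Nat.cast_sum, sum_Tset_sub] at hpsi
  have hpot := (sum_card_Tset_le (by omega) hreach le_rfl).trans
    (Nat.add_le_add_left (sum_min_card_Tset_le hk hn hwidth hm1) (PhiK P n))
  have hpot' := (Nat.cast_le (α := ℝ)).2 hpot
  rw [Nat.cast_add, Nat.cast_add, Nat.cast_mul, Nat.cast_sub hm1, Nat.cast_sub hn,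
    Nat.cast_one] at hpot'
  change _ ≤ _ - (PhiK P n : ℝ) at hpsi
  linarith
end

section
/- For all integers k ≥ 2, n ≥ 1, w ≥ 1 and every real Δ with 0 ≤ Δ ≤ n/(2(k−1)): if there exists a length-n width-w ROBP over alphabet [k] that computes ApproxCount_k[n,Δ], then Δ ≥ n/(2(k−1)) − ((k!)^{1/k}/(2(k−1))) · (n·w)^{1/k}. -/
open Finset

namespace ApproxCountLowerBound

lemma mem_Tset {k t : ℕ} {x : Fin (k - 1) → ℕ} : x ∈ Tset k t ↔ ∑ j, x j ≤ t := by
  simp only [Tset, mem_filter, Fintype.mem_piFinset, mem_range, and_iff_right_iff_imp]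
  intro h j
  have := single_le_sum (f := x) (fun _ _ => Nat.zero_le _) (mem_univ j)
  omega

lemma card_Tset (k t : ℕ) : (Tset k t).card = (t + (k - 1)).choose (k - 1) := by
  rw [← Nat.sum_range_multichoose]
  have hmaps : ∀ x ∈ Tset k t, ∑ j, x j ∈ range (t + 1) := fun x hx =>
    mem_range.2 (Nat.lt_succ_of_le (mem_Tset.1 hx))
  rw [card_eq_sum_card_fiberwise hmaps]
  refine sum_congr rfl fun s hs => ?_
  have hcard := card_finsuppAntidiag_nat_eq_multichoose (s := (univ : Finset (Fin (k - 1)))) s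
  rw [card_univ, Fintype.card_fin] at hcard
  rw [← hcard]
  refine card_bij' (fun x _ => Finsupp.equivFunOnFinite.symm x) (fun f _ => ⇑f) ?_ ?_ ?_ ?_
  · intro x hx
    simpa [mem_finsuppAntidiag] using (mem_filter.1 hx).2
  · intro f hf
    have hsum : ∑ j, f j = s := by simpa [mem_finsuppAntidiag] using hf
    refine mem_filter.2 ⟨mem_Tset.2 ?_, hsum⟩
    have := mem_range.1 hs
    omega
  · intro x _
    simp
  · intro f _
    ext
    simp

/-- The discrete simplices of size below `N` have total volume at least `N ^ k / k!`. -/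
lemma pow_le_factorial_mul_sum_card_Tset (k N : ℕ) (hk : 1 ≤ k) :
    N ^ k ≤ k.factorial * ∑ t ∈ range N, (Tset k t).card := by
  obtain ⟨m, rfl⟩ : ∃ m, k = m + 1 := ⟨k - 1, by omega⟩
  cases N with
  | zero => simp
  | succ N =>
    simp only [card_Tset, Nat.add_sub_cancel]
    rw [Nat.sum_range_add_choose, add_assoc, ← Nat.ascFactorial_eq_factorial_mul_choose]
    exact Nat.pow_succ_le_ascFactorial (N + 1) (m + 1)

/-- Counting the points below each level equals summing the distances to the top level. -/
lemma sum_card_Tset {k n N : ℕ} (hN : N ≤ n + 1) :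
    ∑ t ∈ range N, (Tset k t).card = ∑ x ∈ Tset k n, (N - ∑ j, x j) := by
  have hcard : ∀ t ∈ range N,
      (Tset k t).card = ∑ x ∈ Tset k n, if ∑ j, x j ≤ t then 1 else 0 := by
    intro t ht
    rw [← card_filter]
    congr 1
    ext x
    have := mem_range.1 ht
    simp only [mem_filter, mem_Tset]
    omega
  rw [sum_congr rfl hcard, sum_comm]
  refine sum_congr rfl fun x _ => ?_
  rw [← card_filter]
  refine Eq.trans (congrArg card ?_) (Nat.card_Ico (∑ j, x j) N)
  ext t
  simp only [mem_filter, mem_range, mem_Ico]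
  tauto

lemma countK_le {k : ℕ} (x : ℕ → Fin k) (t : ℕ) (j : Fin k) : countK x t j ≤ t :=
  (card_filter_le _ _).trans (card_range t).le

lemma countK_succ {k : ℕ} (x : ℕ → Fin k) (t : ℕ) (j : Fin k) :
    countK x (t + 1) j = countK x t j + if x t = j then 1 else 0 := by
  unfold countK
  rw [range_add_one, filter_insert]
  split_ifs <;> simp

lemma state_update {σ Out : Type} {n : ℕ} (P : ROBP σ Out n) (x : ℕ → σ) (t : ℕ) (c : σ)
    (s : ℕ) (hs : s ≤ t) : P.state (Function.update x t c) s = P.state x s := by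
  induction s with
  | zero => rfl
  | succ s ih =>
    simp only [ROBP.state]
    rw [ih (by omega), Function.update_of_ne (by omega)]

lemma countK_update {k : ℕ} (x : ℕ → Fin k) (t : ℕ) (c j : Fin k) :
    countK (Function.update x t c) t j = countK x t j := by
  unfold countK
  congr 1
  refine filter_congr fun i hi => ?_
  rw [Function.update_of_ne (mem_range.1 hi).ne]

lemma exists_extend {k n : ℕ} (P : ROBP (Fin k) (Fin k → ℝ) n) (y : ℕ → Fin k) (t : ℕ)
    (c : Fin k) :
    ∃ z : ℕ → Fin k, P.state z (t + 1) = P.step t (P.state y t) c ∧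
      ∀ j, countK z (t + 1) j = countK y t j + if c = j then 1 else 0 := by
  refine ⟨Function.update y t c, ?_, fun j => ?_⟩
  · simp only [ROBP.state]
    rw [state_update P y t c t le_rfl, Function.update_self]
  · rw [countK_succ, countK_update, Function.update_self]

variable {k n : ℕ} {P : ROBP (Fin k) (Fin k → ℝ) n}

lemma rectLo_le (y : ℕ → Fin k) (t : ℕ) (j : Fin (k - 1)) :
    rectLo P t (P.state y t) j ≤ countK y t (idx j) :=
  Nat.sInf_le ⟨y, rfl, rfl⟩

lemma bddAbove_counts (t : ℕ) (v : Fin (P.size t)) (j : Fin (k - 1)) :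
    BddAbove {c | ∃ x : ℕ → Fin k, P.state x t = v ∧ countK x t (idx j) = c} :=
  ⟨t, by rintro _ ⟨x, -, rfl⟩; exact countK_le x t _⟩

lemma le_rectHi (y : ℕ → Fin k) (t : ℕ) (j : Fin (k - 1)) :
    countK y t (idx j) ≤ rectHi P t (P.state y t) j :=
  le_csSup (bddAbove_counts t _ j) ⟨y, rfl, rfl⟩

lemma exists_countK_eq_rectLo (hP : P.Reachable) {t : ℕ} (ht : t ≤ n) (v : Fin (P.size t))
    (j : Fin (k - 1)) :
    ∃ x : ℕ → Fin k, P.state x t = v ∧ countK x t (idx j) = rectLo P t v j := by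
  obtain ⟨x, hx⟩ := hP t ht v
  exact Nat.sInf_mem (s := {c | ∃ x : ℕ → Fin k, P.state x t = v ∧ countK x t (idx j) = c})
    ⟨_, x, hx, rfl⟩

lemma exists_countK_eq_rectHi (hP : P.Reachable) {t : ℕ} (ht : t ≤ n) (v : Fin (P.size t))
    (j : Fin (k - 1)) :
    ∃ x : ℕ → Fin k, P.state x t = v ∧ countK x t (idx j) = rectHi P t v j := by
  obtain ⟨x, hx⟩ := hP t ht v
  exact Nat.sSup_mem (s := {c | ∃ x : ℕ → Fin k, P.state x t = v ∧ countK x t (idx j) = c})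
    ⟨_, x, hx, rfl⟩ (bddAbove_counts t v j)

lemma rectLo_step_le (hP : P.Reachable) {t : ℕ} (ht : t ≤ n) (v : Fin (P.size t)) (c : Fin k)
    (j : Fin (k - 1)) :
    rectLo P (t + 1) (P.step t v c) j ≤ rectLo P t v j + if c = idx j then 1 else 0 := by
  obtain ⟨y, rfl, hy⟩ := exists_countK_eq_rectLo hP ht v j
  obtain ⟨z, hz, hcount⟩ := exists_extend P y t c
  rw [← hy, ← hcount, ← hz]
  exact rectLo_le z (t + 1) j

lemma le_rectHi_step (hP : P.Reachable) {t : ℕ} (ht : t ≤ n) (v : Fin (P.size t)) (c : Fin k)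
    (j : Fin (k - 1)) :
    (rectHi P t v j + if c = idx j then 1 else 0) ≤ rectHi P (t + 1) (P.step t v c) j := by
  obtain ⟨y, rfl, hy⟩ := exists_countK_eq_rectHi hP ht v j
  obtain ⟨z, hz, hcount⟩ := exists_extend P y t c
  rw [← hy, ← hcount, ← hz]
  exact le_rectHi z (t + 1) j

lemma idx_injective : Function.Injective (idx (k := k)) := Fin.castLE_injective (Nat.sub_le k 1)

lemma exists_ne_idx (hk : 1 ≤ k) : ∃ c : Fin k, ∀ j, c ≠ idx j := by
  refine ⟨⟨k - 1, by omega⟩, fun j h => ?_⟩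
  have := congrArg Fin.val h
  have := j.isLt
  simp only [idx, Fin.val_castLE] at *
  omega

/-- Every point of the simplex is the vector of letter counts of some word. -/
lemma exists_word (hk : 1 ≤ k) (t : ℕ) (x : Fin (k - 1) → ℕ) (hx : ∑ j, x j ≤ t) :
    ∃ y : ℕ → Fin k, ∀ j, countK y t (idx j) = x j := by
  induction t generalizing x with
  | zero =>
    have hzero : ∀ j, x j = 0 := by simpa using hx
    exact ⟨fun _ => ⟨0, hk⟩, fun j => by simp [countK, hzero]⟩
  | succ t ih =>
    have hstep : ∀ (x' : Fin (k - 1) → ℕ) (c : Fin k), ∑ j, x' j ≤ t →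
        (∀ j, x j = x' j + if c = idx j then 1 else 0) →
        ∃ y : ℕ → Fin k, ∀ j, countK y (t + 1) (idx j) = x j := by
      intro x' c hx' hc
      obtain ⟨y, hy⟩ := ih x' hx'
      refine ⟨Function.update y t c, fun j => ?_⟩
      rw [countK_succ, countK_update, Function.update_self, hy, hc]
    by_cases hlt : ∑ j, x j ≤ t
    · obtain ⟨c, hc⟩ := exists_ne_idx hk
      exact hstep x c hlt fun j => by simp [hc j]
    · obtain ⟨i, -, hi⟩ : ∃ i ∈ univ, x i ≠ 0 := by
        by_contra! hcon
        exact hlt ((sum_eq_zero hcon).trans_le t.zero_le)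
      have hx' : ∀ j, x j = (x j - if i = j then 1 else 0) + if i = j then 1 else 0 := by
        intro j
        split_ifs with hij
        · subst hij
          omega
        · rfl
      refine hstep (fun j => x j - if i = j then 1 else 0) (idx i) ?_ fun j => ?_
      · have hsum := sum_congr (rfl : (univ : Finset (Fin (k - 1))) = univ) fun j _ => hx' j
        rw [sum_add_distrib, sum_ite_eq, if_pos (mem_univ i)] at hsum
        change ∑ j, x j = _ at hsum
        omega
      · simpa only [idx_injective.eq_iff] using hx' j

lemma exists_rect_mem (hk : 1 ≤ k) (P : ROBP (Fin k) (Fin k → ℝ) n) {t : ℕ}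
    {x : Fin (k - 1) → ℕ} (hx : x ∈ Tset k t) :
    ∃ v : Fin (P.size t), ∀ j, rectLo P t v j ≤ x j ∧ x j ≤ rectHi P t v j := by
  obtain ⟨y, hy⟩ := exists_word hk t x (mem_Tset.1 hx)
  exact ⟨P.state y t, fun j => hy j ▸ ⟨rectLo_le y t j, le_rectHi y t j⟩⟩

lemma le_phiK {t : ℕ} {x : Fin (k - 1) → ℕ} {v : Fin (P.size t)}
    (hv : ∀ j, rectLo P t v j ≤ x j ∧ x j ≤ rectHi P t v j) :
    min (∑ j, rectHi P t v j) t - ∑ j, x j ≤ phiK P t x := by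
  have := le_sup (f := fun v : Fin (P.size t) =>
    if ∀ j, rectLo P t v j ≤ x j ∧ x j ≤ rectHi P t v j then
      min (∑ j, rectHi P t v j) t - ∑ j, x j else 0) (mem_univ v)
  simpa only [phiK, if_pos hv] using this

lemma exists_phiK_eq (hk : 1 ≤ k) {t : ℕ} {x : Fin (k - 1) → ℕ} (hx : x ∈ Tset k t) :
    ∃ v : Fin (P.size t), (∀ j, rectLo P t v j ≤ x j ∧ x j ≤ rectHi P t v j) ∧
      phiK P t x = min (∑ j, rectHi P t v j) t - ∑ j, x j := by
  obtain ⟨u, hu⟩ := exists_rect_mem hk P hx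
  obtain ⟨v, -, hv⟩ := exists_mem_eq_sup (univ : Finset (Fin (P.size t))) ⟨u, mem_univ u⟩
    fun v => if ∀ j, rectLo P t v j ≤ x j ∧ x j ≤ rectHi P t v j then
      min (∑ j, rectHi P t v j) t - ∑ j, x j else 0
  by_cases h : ∀ j, rectLo P t v j ≤ x j ∧ x j ≤ rectHi P t v j
  · exact ⟨v, h, by rw [phiK, hv, if_pos h]⟩
  · have hzero : phiK P t x = 0 := by rw [phiK, hv, if_neg h]
    exact ⟨u, hu, by have := le_phiK hu; omega⟩

/-- A point's potential never decreases, and it grows unless the point is the lower corner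
of some rectangle. -/
lemma phiK_succ (hk : 1 ≤ k) (hP : P.Reachable) {t : ℕ} (ht : t ≤ n)
    {x : Fin (k - 1) → ℕ} (hx : x ∈ Tset k t) :
    phiK P t x + 1 ≤ phiK P (t + 1) x + if x ∈ univ.image (rectLo P t) then 1 else 0 := by
  obtain ⟨v, hv, hphi⟩ := exists_phiK_eq (P := P) hk hx
  have hxt := mem_Tset.1 hx
  have hxb : ∑ j, x j ≤ ∑ j, rectHi P t v j := sum_le_sum fun j _ => (hv j).2
  split_ifs with hcorner
  · obtain ⟨c, hc⟩ := exists_ne_idx hk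
    have hlo := rectLo_step_le hP ht v c
    have hhi := le_rectHi_step hP ht v c
    simp only [if_neg (hc _), add_zero] at hlo hhi
    have hle := le_phiK fun j => ⟨(hlo j).trans (hv j).1, (hv j).2.trans (hhi j)⟩
    have hsum := sum_le_sum (s := univ) fun j _ => hhi j
    omega
  · obtain ⟨i, hi⟩ : ∃ i, rectLo P t v i ≠ x i := by
      by_contra! hcon
      exact hcorner (mem_image.2 ⟨v, mem_univ v, funext hcon⟩)
    have hlo := rectLo_step_le hP ht v (idx i)
    have hhi := le_rectHi_step hP ht v (idx i)
    simp only [idx_injective.eq_iff] at hlo hhi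
    have hmem : ∀ j, rectLo P (t + 1) (P.step t v (idx i)) j ≤ x j ∧
        x j ≤ rectHi P (t + 1) (P.step t v (idx i)) j := by
      intro j
      have h1 := hlo j
      have h2 := hhi j
      have h3 := hv j
      split_ifs at h1 h2 with hij
      · subst hij
        omega
      · omega
    have hle := le_phiK hmem
    have hsum := sum_le_sum (s := univ) fun j _ => hhi j
    rw [sum_add_distrib, sum_ite_eq] at hsum
    simp only [mem_univ, if_true] at hsum
    omega

lemma PhiK_succ (hk : 1 ≤ k) (hP : P.Reachable) {t : ℕ} (ht : t ≤ n) :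
    PhiK P t + (Tset k t).card ≤ PhiK P (t + 1) + P.size t := by
  have hsubset : Tset k t ⊆ Tset k (t + 1) := fun x hx =>
    mem_Tset.2 ((mem_Tset.1 hx).trans t.le_succ)
  have hcorners : (∑ x ∈ Tset k t, if x ∈ univ.image (rectLo P t) then 1 else 0) ≤ P.size t := by
    rw [← card_filter]
    calc _ ≤ (univ.image (rectLo P t)).card := card_le_card fun x hx => (mem_filter.1 hx).2
      _ ≤ _ := card_image_le.trans (by simp)
  calc PhiK P t + (Tset k t).card = ∑ x ∈ Tset k t, (phiK P t x + 1) := by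
        rw [sum_add_distrib, PhiK, card_eq_sum_ones]
    _ ≤ ∑ x ∈ Tset k t,
          (phiK P (t + 1) x + if x ∈ univ.image (rectLo P t) then 1 else 0) :=
        sum_le_sum fun x hx => phiK_succ hk hP ht hx
    _ ≤ PhiK P (t + 1) + P.size t := by
        rw [sum_add_distrib]
        exact add_le_add (sum_le_sum_of_subset hsubset) hcorners

lemma sum_card_le_PhiK (hk : 1 ≤ k) (hP : P.Reachable) {w : ℕ} (hw : P.width ≤ w) (t : ℕ)
    (ht : t ≤ n) : ∑ s ∈ range t, (Tset k s).card ≤ PhiK P t + t * w := by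
  induction t with
  | zero => simp
  | succ t ih =>
    have hsize : P.size t ≤ w := (le_sup (mem_range.2 (by omega))).trans hw
    have := PhiK_succ hk hP (show t ≤ n by omega)
    have := ih (by omega)
    rw [sum_range_succ, Nat.succ_mul]
    omega

/-- In the last layer, all rectangles have side lengths at most `2Δ`. -/
lemma phiK_last_le (hk : 1 ≤ k) (hP : P.Reachable) {Δ : ℝ} (hΔ : ComputesApproxCountK k n Δ P)
    {x : Fin (k - 1) → ℕ} (hx : x ∈ Tset k n) :
    phiK P n x ≤ min ⌊2 * ((k : ℝ) - 1) * Δ⌋₊ (n - ∑ j, x j) := by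
  obtain ⟨v, hv, hphi⟩ := exists_phiK_eq (P := P) hk hx
  have hside : ∀ j, (rectHi P n v j : ℝ) - x j ≤ 2 * Δ := by
    intro j
    obtain ⟨y, hy, hyc⟩ := exists_countK_eq_rectLo hP le_rfl v j
    obtain ⟨z, hz, hzc⟩ := exists_countK_eq_rectHi hP le_rfl v j
    have h1 := abs_le.1 (hΔ y (idx j))
    have h2 := abs_le.1 (hΔ z (idx j))
    rw [ROBP.eval, hy, hyc] at h1
    rw [ROBP.eval, hz, hzc] at h2
    have h3 : (rectLo P n v j : ℝ) ≤ x j := by exact_mod_cast (hv j).1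
    linarith [h1.2, h2.1]
  have hxb : ∑ j, x j ≤ ∑ j, rectHi P n v j := sum_le_sum fun j _ => (hv j).2
  have hfloor : ∑ j, rectHi P n v j - ∑ j, x j ≤ ⌊2 * ((k : ℝ) - 1) * Δ⌋₊ := by
    refine Nat.le_floor ?_
    rw [Nat.cast_sub hxb, Nat.cast_sum, Nat.cast_sum, ← sum_sub_distrib]
    refine (sum_le_card_nsmul univ _ _ fun j _ => hside j).trans (le_of_eq ?_)
    rw [card_univ, Fintype.card_fin, nsmul_eq_mul, Nat.cast_sub hk, Nat.cast_one]
    ring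
  omega

lemma pow_le_factorial_mul (hk : 1 ≤ k) (hP : P.Reachable) {w : ℕ} (hw : P.width ≤ w) {Δ : ℝ}
    (hΔ : ComputesApproxCountK k n Δ P) :
    (n - ⌊2 * ((k : ℝ) - 1) * Δ⌋₊) ^ k ≤ k.factorial * (n * w) := by
  refine (pow_le_factorial_mul_sum_card_Tset k _ hk).trans (Nat.mul_le_mul_left _ ?_)
  have hlow := sum_card_le_PhiK hk hP hw n le_rfl
  set D := ⌊2 * ((k : ℝ) - 1) * Δ⌋₊
  have hup : PhiK P n ≤ ∑ x ∈ Tset k n, min D (n - ∑ j, x j) :=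
    sum_le_sum fun x hx => phiK_last_le hk hP hΔ hx
  rw [sum_card_Tset n.le_succ] at hlow
  rw [sum_card_Tset (show n - D ≤ n + 1 by omega)]
  have hsplit : ∑ x ∈ Tset k n, (n - ∑ j, x j) =
      ∑ x ∈ Tset k n, min D (n - ∑ j, x j) + ∑ x ∈ Tset k n, (n - D - ∑ j, x j) := by
    rw [← sum_add_distrib]
    refine sum_congr rfl fun x _ => ?_
    omega
  omega

end ApproxCountLowerBound

/-- if a length-`n` width-`w` ROBP over `[k]` computes
`ApproxCount_k[n, Δ]` with `0 ≤ Δ ≤ n/(2(k-1))`, then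
`Δ ≥ n/(2(k-1)) - ((k!)^{1/k}/(2(k-1))) · (n·w)^{1/k}`. -/
theorem stmt6 (k n w : ℕ) (hk : 2 ≤ k) (hn : 1 ≤ n) (hw : 1 ≤ w)
    (Δ : ℝ) (hΔ0 : 0 ≤ Δ) (hΔ1 : Δ ≤ (n : ℝ) / (2 * ((k : ℝ) - 1)))
    (h : ∃ P : ROBP (Fin k) (Fin k → ℝ) n, P.Reachable ∧ P.width ≤ w ∧
      ComputesApproxCountK k n Δ P) :
    Δ ≥ (n : ℝ) / (2 * ((k : ℝ) - 1)) -
      (Nat.factorial k : ℝ) ^ ((1 : ℝ) / (k : ℝ)) / (2 * ((k : ℝ) - 1)) *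
        ((n : ℝ) * (w : ℝ)) ^ ((1 : ℝ) / (k : ℝ)) := by
  obtain ⟨P, hP, hwidth, hcomp⟩ := h
  have hpow := ApproxCountLowerBound.pow_le_factorial_mul (by omega : 1 ≤ k) hP hwidth hcomp
  have hk' : (2 : ℝ) ≤ k := by exact_mod_cast hk
  have hpos : 0 < 2 * ((k : ℝ) - 1) := by linarith
  have hnonneg : 0 ≤ 2 * ((k : ℝ) - 1) * Δ := mul_nonneg hpos.le hΔ0
  have hfloor := Nat.floor_le hnonneg
  set D := ⌊2 * ((k : ℝ) - 1) * Δ⌋₊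
  have hroot : ((n - D : ℕ) : ℝ) ≤ ((k.factorial : ℝ) * (n * w)) ^ ((1 : ℝ) / k) := by
    rw [one_div, Real.le_rpow_inv_iff_of_pos (by positivity) (by positivity) (by positivity),
      Real.rpow_natCast]
    exact_mod_cast hpow
  have hsub : (n : ℝ) ≤ ((n - D : ℕ) : ℝ) + D := by
    exact_mod_cast (by omega : n ≤ n - D + D)
  rw [Real.mul_rpow (by positivity) (by positivity)] at hroot
  rw [ge_iff_le, div_mul_eq_mul_div, ← sub_div, div_le_iff₀ hpos]
  linarith
end
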